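/- arXiv:1112.0939 — 5 statements merged into one kernel-verified Lean document; each statement's English description precedes it below -/
import Mathlib

section
/- For every n ≥ 1, h ∈ (0,1] with nh ∈ ℕ and h⁻¹ ∈ ℕ, every j ∈ {1,…,nh}, k ∈ {0,…,h⁻¹−1} and every l ∈ {0,…,n−1}, one has Φ_{jk}((l+1)/n) − Φ_{jk}(l/n) = n⁻¹ · φ_{jk}((l+1/2)/n). -/
open Real Set

/-- The spectral weight function `φ_{jk}(t) = √(2/h)·cos(jπh⁻¹(t−kh))·1_{[kh,(k+1)h]}(t)`. -/
noncomputable def phiSpec (h : ℝ) (j k : ℕ) (t : ℝ) : ℝ :=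
  Set.indicator (Set.Icc ((k : ℝ) * h) (((k : ℝ) + 1) * h))
    (fun s => Real.sqrt (2 / h) * Real.cos ((j : ℝ) * Real.pi * h⁻¹ * (s - (k : ℝ) * h))) t

/-- The renormalized antiderivative
`Φ_{jk}(t) = (√(2h)·n·sin(jπ/(2nh)))⁻¹·sin(jπh⁻¹(t−kh))·1_{[kh,(k+1)h]}(t)`. -/
noncomputable def PhiSpec (n : ℕ) (h : ℝ) (j k : ℕ) (t : ℝ) : ℝ :=
  Set.indicator (Set.Icc ((k : ℝ) * h) (((k : ℝ) + 1) * h))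
    (fun s => (Real.sqrt (2 * h) * (n : ℝ) * Real.sin ((j : ℝ) * Real.pi / (2 * (n : ℝ) * h)))⁻¹ *
      Real.sin ((j : ℝ) * Real.pi * h⁻¹ * (s - (k : ℝ) * h))) t

/-- `Φ_{jk}` vanishes outside the open block `(kh,(k+1)h)`, in particular at its end points. -/
theorem PhiSpec_eq_zero (n : ℕ) {h : ℝ} (hh : h ≠ 0) (j k : ℕ) {t : ℝ}
    (ht : t ≤ (k : ℝ) * h ∨ ((k : ℝ) + 1) * h ≤ t) : PhiSpec n h j k t = 0 := by
  unfold PhiSpec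
  refine Set.indicator_apply_eq_zero.2 fun hmem => mul_eq_zero_of_right _ ?_
  rcases ht with ht | ht
  · rw [le_antisymm ht hmem.1, sub_self, mul_zero, Real.sin_zero]
  · rw [le_antisymm hmem.2 ht,
      show (j : ℝ) * π * h⁻¹ * (((k : ℝ) + 1) * h - k * h) = j * π by field_simp; ring]
    exact Real.sin_nat_mul_pi j

/-- The finite-difference identity between `Φ_{jk}` and `φ_{jk}` when the whole step lies in the
block. -/
theorem PhiSpec_sub_eq_of_mem {n : ℕ} (hn : n ≠ 0) {h : ℝ} (hh : 0 < h) (j k : ℕ) {x : ℝ}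
    (hs : Real.sin ((j : ℝ) * π / (2 * (n : ℝ) * h)) ≠ 0)
    (h1 : (k : ℝ) * h ≤ x / n) (h2 : (x + 1) / n ≤ ((k : ℝ) + 1) * h) :
    PhiSpec n h j k ((x + 1) / n) - PhiSpec n h j k (x / n) =
      (n : ℝ)⁻¹ * phiSpec h j k ((x + 1 / 2) / n) := by
  have hn' : (0 : ℝ) < n := by positivity
  have h3 : x / n ≤ (x + 1 / 2) / n := by gcongr; linarith
  have h4 : (x + 1 / 2) / n ≤ (x + 1) / n := by gcongr; norm_num
  have m0 : x / n ∈ Set.Icc ((k : ℝ) * h) (((k : ℝ) + 1) * h) := ⟨h1, by linarith⟩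
  have m1 : (x + 1) / n ∈ Set.Icc ((k : ℝ) * h) (((k : ℝ) + 1) * h) := ⟨by linarith, h2⟩
  have m2 : (x + 1 / 2) / n ∈ Set.Icc ((k : ℝ) * h) (((k : ℝ) + 1) * h) :=
    ⟨by linarith, by linarith⟩
  unfold PhiSpec phiSpec
  rw [Set.indicator_of_mem m0, Set.indicator_of_mem m1, Set.indicator_of_mem m2, ← mul_sub,
    Real.sin_sub_sin]
  have e1 : ((j : ℝ) * π * h⁻¹ * ((x + 1) / n - k * h) - j * π * h⁻¹ * (x / n - k * h)) / 2 =
      j * π / (2 * n * h) := by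
    field_simp; ring
  have e2 : ((j : ℝ) * π * h⁻¹ * ((x + 1) / n - k * h) + j * π * h⁻¹ * (x / n - k * h)) / 2 =
      j * π * h⁻¹ * ((x + 1 / 2) / n - k * h) := by
    field_simp; ring
  have e3 : Real.sqrt (2 / h) * Real.sqrt (2 * h) = 2 := by
    rw [← Real.sqrt_mul (by positivity), show 2 / h * (2 * h) = 2 ^ 2 by field_simp]
    exact Real.sqrt_sq (by norm_num)
  have e4 : Real.sqrt (2 * h) ≠ 0 := by positivity
  rw [e1, e2, eq_div_of_mul_eq e4 e3]
  generalize Real.sin ((j : ℝ) * π / (2 * n * h)) = s at hs ⊢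
  generalize Real.cos _ = c
  field_simp

/-- For every `n ≥ 1`, `h ∈ (0,1]` with `nh ∈ ℕ` and `h⁻¹ ∈ ℕ`, every
`j ∈ {1,…,nh}`, `k ∈ {0,…,h⁻¹−1}` and every `l ∈ {0,…,n−1}`, one has
`Φ_{jk}((l+1)/n) − Φ_{jk}(l/n) = n⁻¹ · φ_{jk}((l+1/2)/n)`. -/
theorem PhiSpec_succ_sub_eq_phiSpec_mid
    (n : ℕ) (hn : 1 ≤ n) (h : ℝ) (hh0 : 0 < h) (hh1 : h ≤ 1)
    (m K : ℕ) (hm : (n : ℝ) * h = (m : ℝ)) (hK : h⁻¹ = (K : ℝ))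
    (j k l : ℕ) (hj1 : 1 ≤ j) (hjm : j ≤ m) (hk : k ≤ K - 1) (hl : l ≤ n - 1) :
    PhiSpec n h j k (((l : ℝ) + 1) / (n : ℝ)) - PhiSpec n h j k ((l : ℝ) / (n : ℝ)) =
      (n : ℝ)⁻¹ * phiSpec h j k (((l : ℝ) + 1 / 2) / (n : ℝ)) := by
  have hn0 : (0 : ℝ) < n := by exact_mod_cast hn
  have hj0 : (0 : ℝ) < j := by exact_mod_cast hj1
  have hjm' : (j : ℝ) ≤ m := by exact_mod_cast hjm
  have hs : Real.sin ((j : ℝ) * π / (2 * (n : ℝ) * h)) ≠ 0 := by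
    refine (Real.sin_pos_of_pos_of_lt_pi (by positivity) ?_).ne'
    rw [div_lt_iff₀ (by positivity), mul_assoc, hm]
    nlinarith [Real.pi_pos]
  have hh : h = m / n := by rw [← hm]; field_simp
  rcases le_or_gt (l + 1) (k * m) with hlt | hge
  · have hlt' : (l : ℝ) + 1 ≤ k * m := by exact_mod_cast hlt
    have hb : ((l : ℝ) + 1) / n ≤ k * h := by
      rw [hh, ← mul_div_assoc]; gcongr
    have h1 : (l : ℝ) / n ≤ ((l : ℝ) + 1) / n := by gcongr; linarith
    have h2 : ((l : ℝ) + 1 / 2) / n < ((l : ℝ) + 1) / n := by gcongr; norm_num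
    rw [PhiSpec_eq_zero n hh0.ne' j k (.inl hb), PhiSpec_eq_zero n hh0.ne' j k (.inl (h1.trans hb)),
      phiSpec, Set.indicator_of_notMem fun hmem => by linarith [hmem.1]]
    simp
  rcases le_or_gt ((k + 1) * m) l with hle | hlt
  · have hle' : ((k : ℝ) + 1) * m ≤ l := by exact_mod_cast hle
    have hb : ((k : ℝ) + 1) * h ≤ (l : ℝ) / n := by
      rw [hh, ← mul_div_assoc]; gcongr
    have h1 : (l : ℝ) / n ≤ ((l : ℝ) + 1) / n := by gcongr; linarith
    have h2 : (l : ℝ) / n < ((l : ℝ) + 1 / 2) / n := by gcongr; linarith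
    rw [PhiSpec_eq_zero n hh0.ne' j k (.inr hb), PhiSpec_eq_zero n hh0.ne' j k (.inr (hb.trans h1)),
      phiSpec, Set.indicator_of_notMem fun hmem => by linarith [hmem.2]]
    simp
  · have hge' : (k : ℝ) * m ≤ l := by exact_mod_cast Nat.lt_succ_iff.1 hge
    have hlt' : (l : ℝ) + 1 ≤ (k + 1) * m := by exact_mod_cast hlt
    refine PhiSpec_sub_eq_of_mem (by omega) hh0 j k hs ?_ ?_
    · rw [hh, ← mul_div_assoc]; gcongr
    · rw [hh, ← mul_div_assoc]; gcongr
end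

section
/- (Proposition 1, orthogonality and norm (6b),(7)) For every k ∈ {0,…,h⁻¹−1} and all j, r ∈ {1,…,nh−1}: ⟨Φ_{jk}, Φ_{rk}⟩_n = δ_{jr} · (4n² sin²(jπ/(2nh)))⁻¹. In particular the empirical norm ‖Φ_{jk}‖_n² = (4n² sin²(jπ/(2nh)))⁻¹ does not depend on the block k. -/
open Real Set Finset

/-- The empirical scalar product `⟨f,g⟩_n = n⁻¹ ∑_{l=1}^n f(l/n) g(l/n)`. -/
noncomputable def empScalar (n : ℕ) (f g : ℝ → ℝ) : ℝ :=
  (n : ℝ)⁻¹ * ∑ l ∈ Finset.Icc 1 n, f ((l : ℝ) / (n : ℝ)) * g ((l : ℝ) / (n : ℝ))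

theorem two_mul_sin_half_mul_sum_cos (x : ℝ) (m : ℕ) :
    2 * Real.sin (x / 2) * ∑ i ∈ Finset.range m, Real.cos (i * x) =
      Real.sin (m * x - x / 2) + Real.sin (x / 2) := by
  induction m with
  | zero => simp
  | succ m ih =>
    rw [Finset.sum_range_succ, mul_add, ih]
    have e : ((m + 1 : ℕ) : ℝ) * x - x / 2 = m * x + x / 2 := by push_cast; ring
    rw [e, Real.sin_add, Real.sin_sub]
    ring

theorem sum_cos_int_mul_pi_div {m : ℕ} (hm : 0 < m) (p : ℤ) (hp : p ≠ 0) (hlt : |p| < 2 * m) :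
    ∑ i ∈ Finset.range m, Real.cos (i * (p * Real.pi / m)) =
      (1 - Real.cos (p * Real.pi)) / 2 := by
  have hm' : (0 : ℝ) < m := by exact_mod_cast hm
  have key := two_mul_sin_half_mul_sum_cos (p * Real.pi / m) m
  have hsin : Real.sin (p * Real.pi / m / 2) ≠ 0 := by
    have hb := abs_lt.1 hlt
    have h1 : -(2 * m : ℝ) < p := by exact_mod_cast hb.1
    have h2 : (p : ℝ) < 2 * m := by exact_mod_cast hb.2
    rw [Ne, Real.sin_eq_zero_iff_of_lt_of_lt]
    · have : (p : ℝ) ≠ 0 := by exact_mod_cast hp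
      positivity
    · rw [div_div, lt_div_iff₀ (by positivity)]
      nlinarith [Real.pi_pos]
    · rw [div_div, div_lt_iff₀ (by positivity)]
      nlinarith [Real.pi_pos]
  have e : (m : ℝ) * (p * Real.pi / m) = p * Real.pi := by field_simp
  rw [e, Real.sin_sub, Real.sin_int_mul_pi] at key
  apply mul_left_cancel₀ (mul_ne_zero two_ne_zero hsin)
  rw [key]
  ring

/-- Orthogonality of the discrete sine system. -/
theorem sum_sin_mul_sin_pi_div {m j r : ℕ} (hj : 1 ≤ j) (hjm : j < m) (hr : 1 ≤ r) (hrm : r < m) :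
    ∑ i ∈ Finset.range m, Real.sin (i * (j * Real.pi / m)) * Real.sin (i * (r * Real.pi / m)) =
      if j = r then (m : ℝ) / 2 else 0 := by
  have hm : 0 < m := by omega
  have hadd := sum_cos_int_mul_pi_div hm (j + r : ℤ) (by omega) (by rw [abs_lt]; omega)
  have hprod : ∀ i : ℕ,
      Real.sin (i * (j * Real.pi / m)) * Real.sin (i * (r * Real.pi / m)) =
      (Real.cos (i * (((j - r : ℤ) : ℝ) * Real.pi / m)) -
        Real.cos (i * (((j + r : ℤ) : ℝ) * Real.pi / m))) / 2 := by
    intro i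
    have e1 : (i : ℝ) * (((j - r : ℤ) : ℝ) * Real.pi / m) =
        i * (j * Real.pi / m) - i * (r * Real.pi / m) := by push_cast; ring
    have e2 : (i : ℝ) * (((j + r : ℤ) : ℝ) * Real.pi / m) =
        i * (j * Real.pi / m) + i * (r * Real.pi / m) := by push_cast; ring
    rw [e1, e2, Real.cos_sub, Real.cos_add]
    ring
  have hcos : Real.cos (((j + r : ℤ) : ℝ) * Real.pi) = Real.cos (((j - r : ℤ) : ℝ) * Real.pi) := by
    push_cast
    rw [add_mul, sub_mul, Real.cos_add, Real.cos_sub, Real.sin_nat_mul_pi]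
    ring
  rw [Finset.sum_congr rfl fun i _ => hprod i, ← Finset.sum_div, Finset.sum_sub_distrib, hadd, hcos]
  split_ifs with hjr
  · subst hjr
    simp
  · rw [sum_cos_int_mul_pi_div hm (j - r : ℤ) (by omega) (by rw [abs_lt]; omega)]
    ring

/-- On the design points, `PhiSpec` is a discrete sine supported in the interior of its block. -/
theorem PhiSpec_natCast_div {n m : ℕ} {h : ℝ} (hn : 0 < n) (hh : 0 < h) (hm : (n : ℝ) * h = m)
    (j k l : ℕ) :
    PhiSpec n h j k ((l : ℝ) / n) =
      if l ∈ Finset.Ico (k * m) (k * m + m) then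
        (Real.sqrt (2 * h) * n * Real.sin (j * Real.pi / (2 * n * h)))⁻¹ *
          Real.sin (((l - k * m : ℕ) : ℝ) * (j * Real.pi / m))
      else 0 := by
  have hn' : (0 : ℝ) < n := by exact_mod_cast hn
  have hlow : (k : ℝ) * h ≤ (l : ℝ) / n ↔ k * m ≤ l := by
    rw [le_div_iff₀ hn', mul_assoc, mul_comm h, hm]
    exact_mod_cast Iff.rfl
  have hupp : (l : ℝ) / n ≤ ((k : ℝ) + 1) * h ↔ l ≤ k * m + m := by
    rw [div_le_iff₀ hn', mul_assoc, mul_comm h, hm, add_mul, one_mul]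
    exact_mod_cast Iff.rfl
  have harg : k * m ≤ l → (j : ℝ) * Real.pi * h⁻¹ * ((l : ℝ) / n - k * h) =
      ((l - k * m : ℕ) : ℝ) * (j * Real.pi / m) := by
    intro hl
    rw [Nat.cast_sub hl, Nat.cast_mul, ← hm]
    field_simp
  unfold PhiSpec
  simp only [Set.indicator_apply, Set.mem_Icc, hlow, hupp, Finset.mem_Ico]
  split_ifs with h1 h2 h2
  · rw [harg h1.1]
  · have hl : l - k * m = m := by omega
    have hm' : (m : ℝ) ≠ 0 := by rw [← hm]; positivity
    rw [harg h1.1, hl, mul_div_cancel₀ _ hm', Real.sin_nat_mul_pi, mul_zero]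
  · omega
  · rfl

/-- Proposition 1, orthogonality and norm (6b),(7): for every
`k ∈ {0,…,h⁻¹−1}` and all `j, r ∈ {1,…,nh−1}`:
`⟨Φ_{jk}, Φ_{rk}⟩_n = δ_{jr} · (4n² sin²(jπ/(2nh)))⁻¹`.  In particular the empirical norm
`‖Φ_{jk}‖_n² = (4n² sin²(jπ/(2nh)))⁻¹` does not depend on the block `k`. -/
theorem empScalar_PhiSpec_orthogonal
    (n : ℕ) (hn : 1 ≤ n) (h : ℝ) (hh0 : 0 < h) (hh1 : h ≤ 1)
    (m K : ℕ) (hm : (n : ℝ) * h = (m : ℝ)) (hK : h⁻¹ = (K : ℝ))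
    (j r k : ℕ) (hj1 : 1 ≤ j) (hjm : j ≤ m - 1) (hr1 : 1 ≤ r) (hrm : r ≤ m - 1)
    (hk : k ≤ K - 1) :
    empScalar n (PhiSpec n h j k) (PhiSpec n h r k) =
      (if j = r then 1 else 0) *
        (4 * (n : ℝ) ^ 2 * Real.sin ((j : ℝ) * Real.pi / (2 * (n : ℝ) * h)) ^ 2)⁻¹ := by
  have hn' : (0 : ℝ) < n := by exact_mod_cast hn
  have hKm : K * m = n := by
    have : (K : ℝ) * m = n := by rw [← hK, ← hm]; field_simp
    exact_mod_cast this
  have hblock : k * m + m ≤ n := by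
    have hK0 : 0 < K := by
      have : (0 : ℝ) < K := by rw [← hK]; positivity
      exact_mod_cast this
    rw [← hKm, ← Nat.succ_mul]
    exact Nat.mul_le_mul_right _ (by omega)
  set f : ℕ → ℝ := fun l => PhiSpec n h j k ((l : ℝ) / n) * PhiSpec n h r k ((l : ℝ) / n) with hf
  set c : ℕ → ℝ := fun q =>
    (Real.sqrt (2 * h) * n * Real.sin (q * Real.pi / (2 * n * h)))⁻¹ with hc
  have hsum : ∑ l ∈ Finset.Icc 1 n, f l = ∑ l ∈ Finset.Ico (k * m) (k * m + m), f l := by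
    have h1 : ∑ l ∈ Finset.Icc 1 n, f l = ∑ l ∈ Finset.range (n + 1), f l := by
      apply Finset.sum_subset
      · intro l
        simp only [Finset.mem_Icc, Finset.mem_range]
        omega
      · intro l hl hl'
        have hl0 : l = 0 := by
          simp only [Finset.mem_Icc, Finset.mem_range] at hl hl'
          omega
        simp [hf, hl0, PhiSpec_natCast_div hn hh0 hm, -Nat.cast_zero]
    rw [h1]
    symm
    apply Finset.sum_subset
    · intro l
      simp only [Finset.mem_Ico, Finset.mem_range]
      omega
    · intro l _ hl
      simp only [hf]
      rw [PhiSpec_natCast_div hn hh0 hm, if_neg hl, zero_mul]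
  have hterm : ∀ i ∈ Finset.range m, f (k * m + i) =
      c j * c r * (Real.sin (i * (j * Real.pi / m)) * Real.sin (i * (r * Real.pi / m))) := by
    intro i hi
    have hmem : k * m + i ∈ Finset.Ico (k * m) (k * m + m) := by
      simp only [Finset.mem_Ico, Finset.mem_range] at hi ⊢
      omega
    simp only [hf]
    rw [PhiSpec_natCast_div hn hh0 hm, PhiSpec_natCast_div hn hh0 hm, if_pos hmem, if_pos hmem,
      Nat.add_sub_cancel_left]
    ring
  unfold empScalar
  rw [hsum, Finset.sum_Ico_eq_sum_range, Nat.add_sub_cancel_left, Finset.sum_congr rfl hterm,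
    ← Finset.mul_sum, sum_sin_mul_sin_pi_div hj1 (by omega) hr1 (by omega)]
  split_ifs with hjr
  · subst hjr
    have hs : Real.sqrt (2 * h) ^ 2 = 2 * h := Real.sq_sqrt (by positivity)
    simp only [hc]
    rw [← hm, ← mul_inv, ← sq, mul_pow, mul_pow, hs, mul_inv, mul_inv, mul_inv]
    field_simp
    norm_num
  · simp
end

section
/- (Proposition 4, eq. (27a)) Let σ > 0 and ρ ∈ (−1,1) with ρ ≠ 0, and define f_2(x) := π⁴x⁴ + 2σ²π²x² + (1+ρ²)σ⁴. Then ∫_0^∞ dx / f_2(x) = (2σ³ρ(1+ρ²)^{1/4})⁻¹ · sin(½(Arg(i − ρ) − π/2)), where Arg denotes the principal argument of a complex number; equivalently, the right-hand side equals (2σ³ρ(1+ρ²)^{1/4})⁻¹ · sin(½ arctan ρ). -/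
open MeasureTheory Real Set

open Filter Topology in
/-- The integral over the half-line of the reciprocal of a positive biquadratic, in factored form. -/
theorem integral_Ioi_inv_biquadratic {c p q : ℝ} (hp : 0 < p) (hq : 0 < q)
    (hpq : p ^ 2 + q ^ 2 = 4 * c) :
    ∫ y in Ioi (0 : ℝ), ((y ^ 2 + p * y + c) * (y ^ 2 - p * y + c))⁻¹ = π / (2 * c * q) := by
  have hc : 0 < c := by nlinarith [sq_pos_of_pos hp, sq_pos_of_pos hq]
  have h₁ (y : ℝ) : 0 < y ^ 2 + p * y + c := by
    nlinarith [sq_nonneg (2 * y + p), sq_pos_of_pos hq]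
  have h₂ (y : ℝ) : 0 < y ^ 2 - p * y + c := by
    nlinarith [sq_nonneg (2 * y - p), sq_pos_of_pos hq]
  set F : ℝ → ℝ := fun y =>
    (4 * p * c)⁻¹ * (log (y ^ 2 + p * y + c) - log (y ^ 2 - p * y + c)) +
      (2 * c * q)⁻¹ * (arctan ((2 * y + p) / q) + arctan ((2 * y - p) / q)) with hF
  have hderiv (y : ℝ) :
      HasDerivAt F ((y ^ 2 + p * y + c) * (y ^ 2 - p * y + c))⁻¹ y := by
    have hd₁ : HasDerivAt (fun y : ℝ => y ^ 2 + p * y + c) (2 * y + p) y := by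
      simpa using ((hasDerivAt_pow 2 y).add ((hasDerivAt_id y).const_mul p)).add_const c
    have hd₂ : HasDerivAt (fun y : ℝ => y ^ 2 - p * y + c) (2 * y - p) y := by
      simpa using ((hasDerivAt_pow 2 y).sub ((hasDerivAt_id y).const_mul p)).add_const c
    have hd₃ : HasDerivAt (fun y : ℝ => (2 * y + p) / q) (2 / q) y := by
      simpa using (((hasDerivAt_id y).const_mul 2).add_const p).div_const q
    have hd₄ : HasDerivAt (fun y : ℝ => (2 * y - p) / q) (2 / q) y := by
      simpa using (((hasDerivAt_id y).const_mul 2).sub_const p).div_const q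
    have hd := (((hd₁.log (h₁ y).ne').sub (hd₂.log (h₂ y).ne')).const_mul (4 * p * c)⁻¹).add
      ((hd₃.arctan.add hd₄.arctan).const_mul (2 * c * q)⁻¹)
    refine hd.congr_deriv ?_
    have e₁ : 1 + ((2 * y + p) / q) ^ 2 = 4 * (y ^ 2 + p * y + c) / q ^ 2 := by
      field_simp
      linear_combination hpq
    have e₂ : 1 + ((2 * y - p) / q) ^ 2 = 4 * (y ^ 2 - p * y + c) / q ^ 2 := by
      field_simp
      linear_combination hpq
    rw [e₁, e₂]
    have n₁ := (h₁ y).ne'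
    have n₂ := (h₂ y).ne'
    generalize hA : y ^ 2 + p * y + c = A at *
    generalize hB : y ^ 2 - p * y + c = B at *
    field_simp
    rw [← hA, ← hB]
    ring
  have hlog : Tendsto (fun y : ℝ => log (y ^ 2 + p * y + c) - log (y ^ 2 - p * y + c))
      atTop (𝓝 0) := by
    have hinv : Tendsto (fun y : ℝ => y⁻¹) atTop (𝓝 0) := tendsto_inv_atTop_zero
    have hnum : Tendsto (fun y : ℝ => 1 + p * y⁻¹ + c * y⁻¹ ^ 2) atTop (𝓝 1) := by
      simpa using ((hinv.const_mul p).const_add 1).add ((hinv.pow 2).const_mul c)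
    have hden : Tendsto (fun y : ℝ => 1 - p * y⁻¹ + c * y⁻¹ ^ 2) atTop (𝓝 1) := by
      simpa using ((hinv.const_mul p).const_sub 1).add ((hinv.pow 2).const_mul c)
    have hlim := (hnum.log one_ne_zero).sub (hden.log one_ne_zero)
    rw [sub_self] at hlim
    refine hlim.congr' ?_
    filter_upwards [eventually_gt_atTop 0] with y hy
    have hy2 : y ^ 2 ≠ 0 := (pow_pos hy 2).ne'
    have e₁ : 1 + p * y⁻¹ + c * y⁻¹ ^ 2 = (y ^ 2 + p * y + c) / y ^ 2 := by field_simp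
    have e₂ : 1 - p * y⁻¹ + c * y⁻¹ ^ 2 = (y ^ 2 - p * y + c) / y ^ 2 := by field_simp
    rw [e₁, e₂, log_div (h₁ y).ne' hy2, log_div (h₂ y).ne' hy2]
    ring
  have harctan (b : ℝ) : Tendsto (fun y : ℝ => arctan ((2 * y + b) / q)) atTop (𝓝 (π / 2)) := by
    refine (tendsto_nhds_of_tendsto_nhdsWithin tendsto_arctan_atTop).comp ?_
    exact (tendsto_atTop_add_const_right _ b
      (tendsto_id.const_mul_atTop two_pos)).atTop_div_const hq
  have hlim : Tendsto F atTop (𝓝 (π / (2 * c * q))) := by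
    have h := (hlog.const_mul (4 * p * c)⁻¹).add
      (((harctan p).add (harctan (-p))).const_mul (2 * c * q)⁻¹)
    have e : (4 * p * c)⁻¹ * 0 + (2 * c * q)⁻¹ * (π / 2 + π / 2) = π / (2 * c * q) := by ring
    simpa only [e, ← sub_eq_add_neg] using h
  rw [integral_Ioi_of_hasDerivAt_of_nonneg' (fun y _ => hderiv y)
    (fun y _ => (inv_pos.2 (mul_pos (h₁ y) (h₂ y))).le) hlim]
  simp [hF, neg_div, arctan_neg]

/-- The half-angle formula for the sine of half an arctangent. -/
theorem sin_arctan_div_two (x : ℝ) :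
    sin (arctan x / 2) = x / (√(√(1 + x ^ 2)) * √(2 * √(1 + x ^ 2) + 2)) := by
  have hc : 0 < √(1 + x ^ 2) := sqrt_pos.2 (by positivity)
  have hcos : 0 < cos (arctan x / 2) := cos_pos_of_mem_Ioo
    ⟨by linarith [neg_pi_div_two_lt_arctan x, pi_pos], by linarith [arctan_lt_pi_div_two x, pi_pos]⟩
  have hs := sin_two_mul (arctan x / 2)
  have hk := cos_two_mul (arctan x / 2)
  rw [mul_div_cancel₀ _ two_ne_zero] at hs hk
  rw [sin_arctan] at hs
  rw [cos_arctan] at hk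
  generalize √(1 + x ^ 2) = c at *
  have hr : 0 < √c := sqrt_pos.2 hc
  have hr2 : √c ^ 2 = c := sq_sqrt hc.le
  have hq : 0 < √(2 * c + 2) := sqrt_pos.2 (by positivity)
  have hq2 : √(2 * c + 2) ^ 2 = 2 * c + 2 := sq_sqrt (by positivity)
  have hC : cos (arctan x / 2) = √(2 * c + 2) / (2 * √c) := by
    rw [← sq_eq_sq₀ hcos.le (by positivity), div_pow, mul_pow, hq2, hr2]
    field_simp at hk ⊢
    linarith
  rw [hC] at hs
  rw [eq_div_iff (by positivity)]
  generalize √(2 * c + 2) = q at *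
  generalize √c = r at *
  subst hr2
  field_simp at hs
  linarith

/-- The argument of `i - x` for real `x`. -/
theorem arg_I_sub_ofReal (x : ℝ) : Complex.arg (Complex.I - (x : ℂ)) = arctan x + π / 2 := by
  have hc : 0 < √(1 + x ^ 2) := sqrt_pos.2 (by positivity)
  have h := Complex.arg_mul_cos_add_sin_mul_I hc (θ := arctan x + π / 2)
    ⟨by linarith [neg_pi_div_two_lt_arctan x, pi_pos], by linarith [arctan_lt_pi_div_two x]⟩
  rw [← h, ← Complex.ofReal_cos, ← Complex.ofReal_sin, cos_add_pi_div_two, sin_add_pi_div_two,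
    sin_arctan, cos_arctan]
  congr 1
  apply Complex.ext <;> simp <;> field_simp


/-- Proposition 4, eq. (27a): for `σ > 0` and `ρ ∈ (−1,1)`, `ρ ≠ 0`, with
`f_2(x) = π⁴x⁴ + 2σ²π²x² + (1+ρ²)σ⁴`:
`∫_0^∞ dx/f_2(x) = (2σ³ρ(1+ρ²)^{1/4})⁻¹ · sin(½(Arg(i−ρ) − π/2))`, equivalently
`= (2σ³ρ(1+ρ²)^{1/4})⁻¹ · sin(½ arctan ρ)`. -/
theorem integral_inv_quartic_correlated (σ ρ : ℝ) (hσ : 0 < σ)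
    (hρ1 : ρ ∈ Set.Ioo (-1 : ℝ) 1) (hρ0 : ρ ≠ 0) :
    (∫ x in Set.Ioi (0 : ℝ),
        (Real.pi ^ 4 * x ^ 4 + 2 * σ ^ 2 * Real.pi ^ 2 * x ^ 2 + (1 + ρ ^ 2) * σ ^ 4)⁻¹) =
      (2 * σ ^ 3 * ρ * (1 + ρ ^ 2) ^ ((1 : ℝ) / 4))⁻¹ *
        Real.sin ((Complex.arg (Complex.I - (ρ : ℂ)) - Real.pi / 2) / 2) ∧
    (∫ x in Set.Ioi (0 : ℝ),
        (Real.pi ^ 4 * x ^ 4 + 2 * σ ^ 2 * Real.pi ^ 2 * x ^ 2 + (1 + ρ ^ 2) * σ ^ 4)⁻¹) =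
      (2 * σ ^ 3 * ρ * (1 + ρ ^ 2) ^ ((1 : ℝ) / 4))⁻¹ * Real.sin (Real.arctan ρ / 2) := by
  have key : (∫ x in Set.Ioi (0 : ℝ),
      (Real.pi ^ 4 * x ^ 4 + 2 * σ ^ 2 * Real.pi ^ 2 * x ^ 2 + (1 + ρ ^ 2) * σ ^ 4)⁻¹) =
      (2 * σ ^ 3 * ρ * (1 + ρ ^ 2) ^ ((1 : ℝ) / 4))⁻¹ * Real.sin (Real.arctan ρ / 2) := by
    have hroot : (1 + ρ ^ 2) ^ ((1 : ℝ) / 4) = √(√(1 + ρ ^ 2)) := by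
      rw [sqrt_eq_rpow, sqrt_eq_rpow, ← rpow_mul (by positivity)]
      norm_num
    rw [sin_arctan_div_two, hroot]
    have hc1 : 1 < √(1 + ρ ^ 2) := by
      rw [lt_sqrt zero_le_one]
      linarith [sq_pos_of_ne_zero hρ0]
    have hc2 : √(1 + ρ ^ 2) ^ 2 = 1 + ρ ^ 2 := sq_sqrt (by positivity)
    generalize √(1 + ρ ^ 2) = c at *
    have hp : 0 < √(2 * c - 2) := sqrt_pos.2 (by linarith)
    have hp2 : √(2 * c - 2) ^ 2 = 2 * c - 2 := sq_sqrt (by linarith)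
    have hq : 0 < √(2 * c + 2) := sqrt_pos.2 (by linarith)
    have hq2 : √(2 * c + 2) ^ 2 = 2 * c + 2 := sq_sqrt (by linarith)
    have hr : 0 < √c := sqrt_pos.2 (by linarith)
    have hr2 : √c ^ 2 = c := sq_sqrt (by linarith)
    have hI := integral_Ioi_inv_biquadratic hp hq (c := c) (by rw [hp2, hq2]; ring)
    have hscale := integral_comp_mul_left_Ioi
      (fun y : ℝ => ((y ^ 2 + √(2 * c - 2) * y + c) * (y ^ 2 - √(2 * c - 2) * y + c))⁻¹) 0
      (div_pos pi_pos hσ)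
    rw [mul_zero, hI] at hscale
    have hint (x : ℝ) :
        (Real.pi ^ 4 * x ^ 4 + 2 * σ ^ 2 * Real.pi ^ 2 * x ^ 2 + (1 + ρ ^ 2) * σ ^ 4)⁻¹ =
        (σ ^ 4)⁻¹ * (((π / σ * x) ^ 2 + √(2 * c - 2) * (π / σ * x) + c) *
          ((π / σ * x) ^ 2 - √(2 * c - 2) * (π / σ * x) + c))⁻¹ := by
      rw [← mul_inv, ← hc2]
      congr 1
      have hy : π * x = σ * (π / σ * x) := by field_simp
      generalize π / σ * x = y at *
      linear_combination ((π * x) ^ 3 + (π * x) ^ 2 * (σ * y) + (π * x) * (σ * y) ^ 2 +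
        (σ * y) ^ 3 + 2 * σ ^ 2 * (π * x + σ * y)) * hy + σ ^ 4 * y ^ 2 * hp2
    simp_rw [hint]
    rw [integral_const_mul, hscale, smul_eq_mul]
    generalize √(2 * c + 2) = q at *
    generalize √c = r at *
    subst hr2
    have hπ := pi_pos.ne'
    field_simp
  refine ⟨?_, key⟩
  rw [key, arg_I_sub_ofReal, add_sub_cancel_right]
end

section
/- (Bilinear interpolation error bound from the proof of Theorem 1) Let α ∈ (0,1] and R > 0, let Σ : [0,1] → ℝ^{2×2} satisfy ‖Σ(t)‖ ≤ R and ‖Σ(t) − Σ(s)‖ ≤ R|t−s|^α for all s,t ∈ [0,1] (spectral norm), and set A(t) := ∫_0^t Σ(s) ds. With the hat functions b_i(t) := max(0, 1 − |nt − i|), i = 1,…,n, there exists a constant C depending only on α such that for every n ≥ 1: ∫_0^1 ∫_0^1 ‖A(min(t,s)) − ∑_{i,j=1}^n A(min(i,j)/n) b_i(t) b_j(s)‖² dt ds ≤ C R² n^{−2−min(2α,1)}. -/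
open MeasureTheory Set Finset intervalIntegral

/-- The spectral norm of a real 2×2 matrix, i.e. the operator norm of the induced map on
Euclidean space. -/
noncomputable def specNorm2 (M : Matrix (Fin 2) (Fin 2) ℝ) : ℝ :=
  ‖LinearMap.toContinuousLinearMap (Matrix.toEuclideanLin M)‖

/-- The linear B-spline (hat function) `b_i(t) = max(0, 1 − |nt − i|)`. -/
noncomputable def hatSpline (n i : ℕ) (t : ℝ) : ℝ :=
  max 0 (1 - |(n : ℝ) * t - (i : ℝ)|)

theorem specNorm2_le_sum_abs (M : Matrix (Fin 2) (Fin 2) ℝ) :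
    specNorm2 M ≤ ∑ i, ∑ j, |M i j| := by
  have hS : 0 ≤ ∑ i, ∑ j, |M i j| := by positivity
  refine ContinuousLinearMap.opNorm_le_bound _ hS fun x => ?_
  have hcoord : ∀ j, |x j| ≤ ‖x‖ := fun j => PiLp.norm_apply_le x j
  have hle : ∀ y : EuclideanSpace ℝ (Fin 2), ‖y‖ ≤ ∑ i, |y i| := by
    intro y
    rw [EuclideanSpace.norm_eq]
    refine Real.sqrt_le_iff.2 ⟨by positivity, ?_⟩
    simp only [Real.norm_eq_abs, Fin.sum_univ_two]
    nlinarith [abs_nonneg (y 0), abs_nonneg (y 1)]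
  refine (hle _).trans ?_
  rw [Finset.sum_mul]
  refine Finset.sum_le_sum fun i _ => ?_
  have : (LinearMap.toContinuousLinearMap (Matrix.toEuclideanLin M) x) i = ∑ j, M i j * x j := by
    rw [LinearMap.coe_toContinuousLinearMap', Matrix.toLpLin_apply]
    rfl
  rw [this, Finset.sum_mul]
  refine (Finset.abs_sum_le_sum_abs _ _).trans (Finset.sum_le_sum fun j _ => ?_)
  rw [abs_mul]
  exact mul_le_mul_of_nonneg_left (hcoord j) (abs_nonneg _)

theorem abs_apply_le_specNorm2 (M : Matrix (Fin 2) (Fin 2) ℝ) (i j : Fin 2) :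
    |M i j| ≤ specNorm2 M := by
  have h := (LinearMap.toContinuousLinearMap (Matrix.toEuclideanLin M)).le_opNorm
    (EuclideanSpace.single j (1 : ℝ))
  have h2 := PiLp.norm_apply_le
    (LinearMap.toContinuousLinearMap (Matrix.toEuclideanLin M) (EuclideanSpace.single j (1 : ℝ))) i
  have h3 : (LinearMap.toContinuousLinearMap (Matrix.toEuclideanLin M)
      (EuclideanSpace.single j (1 : ℝ))) i = M i j := by
    simp [Matrix.toLpLin_apply]
  rw [h3, Real.norm_eq_abs] at h2
  refine h2.trans (h.trans ?_)
  simp [specNorm2]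

theorem hatSpline_nonneg (n i : ℕ) (t : ℝ) : 0 ≤ hatSpline n i t := le_max_left _ _

theorem abs_sub_lt_of_hatSpline_ne_zero {n i : ℕ} (hn : 0 < n) {t : ℝ}
    (h : hatSpline n i t ≠ 0) : |(i : ℝ) / n - t| < 1 / n := by
  have hN : (0 : ℝ) < n := by exact_mod_cast hn
  have h1 : |(n : ℝ) * t - i| < 1 := by
    by_contra! hc
    exact h (max_eq_left (by linarith))
  have h2 : (i : ℝ) / n - t = -((n : ℝ) * t - i) / n := by field_simp; ring
  rw [h2, abs_div, abs_neg, abs_of_pos hN]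
  exact div_lt_div_of_pos_right h1 hN

/-- Interpolation at the nodes `0, …, n` with hat functions reproduces affine functions. -/
theorem sum_max_one_sub_abs_mul_affine (a d : ℝ) (n : ℕ) {x : ℝ} (h0 : 0 ≤ x) (h1 : x ≤ n) :
    ∑ i ∈ Finset.range (n + 1), max 0 (1 - |x - (i : ℝ)|) * (a + d * i) = a + d * x := by
  induction n with
  | zero =>
    have : x = 0 := le_antisymm (by simpa using h1) h0
    simp [this]
  | succ n ih =>
    rw [Finset.sum_range_succ]
    push_cast at h1 ⊢
    rcases le_total x n with h | h
    · rw [ih h, max_eq_left, zero_mul, add_zero]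
      rw [abs_of_nonpos (by linarith)]
      linarith
    · rw [Finset.sum_range_succ, Finset.sum_eq_zero, abs_of_nonneg (by linarith : 0 ≤ x - n),
        abs_of_nonpos (by linarith : x - (n + 1 : ℝ) ≤ 0), max_eq_right (by linarith),
        max_eq_right (by linarith)]
      · ring
      · intro i hi
        have hi' : (i : ℝ) + 1 ≤ n := by exact_mod_cast Finset.mem_range.1 hi
        rw [max_eq_left, zero_mul]
        rw [abs_of_nonneg (by linarith)]
        linarith

theorem sum_hatSpline {n : ℕ} {t : ℝ} (ht : t ∈ Set.Icc (0 : ℝ) 1) :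
    ∑ i ∈ Finset.range (n + 1), hatSpline n i t = 1 := by
  simpa [hatSpline] using sum_max_one_sub_abs_mul_affine 1 0 n
    (mul_nonneg n.cast_nonneg ht.1) (mul_le_of_le_one_right n.cast_nonneg ht.2)

theorem sum_hatSpline_mul_node_sub {n : ℕ} (hn : 0 < n) {t : ℝ} (ht : t ∈ Set.Icc (0 : ℝ) 1) :
    ∑ i ∈ Finset.range (n + 1), hatSpline n i t * ((i : ℝ) / n - t) = 0 := by
  have hN : (n : ℝ) ≠ 0 := by exact_mod_cast hn.ne'
  have h := sum_max_one_sub_abs_mul_affine (-t) (1 / n) n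
    (mul_nonneg n.cast_nonneg ht.1) (mul_le_of_le_one_right n.cast_nonneg ht.2)
  have h2 : -t + 1 / n * (n * t) = 0 := by field_simp; ring
  rw [h2] at h
  rw [← h]
  refine Finset.sum_congr rfl fun i _ => ?_
  rw [hatSpline]
  ring

theorem sum_hatSpline_mul_hatSpline {n : ℕ} {t s : ℝ} (ht : t ∈ Set.Icc (0 : ℝ) 1)
    (hs : s ∈ Set.Icc (0 : ℝ) 1) :
    ∑ i ∈ Finset.range (n + 1), ∑ j ∈ Finset.range (n + 1),
      hatSpline n i t * hatSpline n j s = 1 := by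
  rw [← Finset.sum_mul_sum, sum_hatSpline ht, sum_hatSpline hs, one_mul]

theorem abs_sum_hatSpline_mul_le {n : ℕ} (hn : 0 < n) {t s K : ℝ}
    (ht : t ∈ Set.Icc (0 : ℝ) 1) (hs : s ∈ Set.Icc (0 : ℝ) 1) (c : ℕ → ℕ → ℝ)
    (hc : ∀ i ∈ Finset.range (n + 1), ∀ j ∈ Finset.range (n + 1),
      |(i : ℝ) / n - t| < 1 / n → |(j : ℝ) / n - s| < 1 / n → |c i j| ≤ K) :
    |∑ i ∈ Finset.range (n + 1), ∑ j ∈ Finset.range (n + 1),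
      hatSpline n i t * hatSpline n j s * c i j| ≤ K := by
  calc _ ≤ ∑ i ∈ Finset.range (n + 1), ∑ j ∈ Finset.range (n + 1),
        hatSpline n i t * hatSpline n j s * K := by
        refine (Finset.abs_sum_le_sum_abs _ _).trans (Finset.sum_le_sum fun i hi => ?_)
        refine (Finset.abs_sum_le_sum_abs _ _).trans (Finset.sum_le_sum fun j hj => ?_)
        by_cases h1 : hatSpline n i t = 0
        · simp [h1]
        by_cases h2 : hatSpline n j s = 0
        · simp [h2]
        have h0 := mul_nonneg (hatSpline_nonneg n i t) (hatSpline_nonneg n j s)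
        rw [abs_mul, abs_of_nonneg h0]
        exact mul_le_mul_of_nonneg_left (hc i hi j hj (abs_sub_lt_of_hatSpline_ne_zero hn h1)
          (abs_sub_lt_of_hatSpline_ne_zero hn h2)) h0
    _ = K := by
        simp_rw [← Finset.sum_mul]
        rw [sum_hatSpline_mul_hatSpline ht hs, one_mul]

theorem natCast_div_mem_Icc {n i : ℕ} (hn : 0 < n) (hi : i ∈ Finset.range (n + 1)) :
    (i : ℝ) / n ∈ Set.Icc (0 : ℝ) 1 := by
  have hN : (0 : ℝ) < n := by exact_mod_cast hn
  have : (i : ℝ) ≤ n := by exact_mod_cast Nat.lt_succ_iff.1 (Finset.mem_range.1 hi)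
  exact ⟨by positivity, (div_le_one hN).2 this⟩

theorem natCast_min_div (n i j : ℕ) :
    ((min i j : ℕ) : ℝ) / n = min ((i : ℝ) / n) ((j : ℝ) / n) := by
  rw [Nat.cast_min, min_div_div_right n.cast_nonneg]

/-- The bilinear interpolation error of `(t, s) ↦ a (min t s)`. -/
noncomputable def interpolationError (a : ℝ → ℝ) (n : ℕ) (t s : ℝ) : ℝ :=
  a (min t s) - ∑ i ∈ Finset.Icc 1 n, ∑ j ∈ Finset.Icc 1 n,
    hatSpline n i t * hatSpline n j s * a ((min i j : ℕ) / (n : ℝ))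

theorem interpolationError_comm (a : ℝ → ℝ) (n : ℕ) (t s : ℝ) :
    interpolationError a n t s = interpolationError a n s t := by
  rw [interpolationError, interpolationError, Finset.sum_comm, min_comm]
  simp_rw [min_comm, mul_comm]

theorem sum_Icc_one_eq_sum_range {g : ℕ → ℝ} (n : ℕ) (hg : g 0 = 0) :
    ∑ i ∈ Finset.Icc 1 n, g i = ∑ i ∈ Finset.range (n + 1), g i := by
  refine Finset.sum_subset (fun i hi => ?_) fun i _ hi' => ?_
  · simp only [Finset.mem_Icc, Finset.mem_range] at *
    omega
  · have : i = 0 := by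
      simp only [Finset.mem_Icc, Finset.mem_range] at *
      omega
    rw [this, hg]

theorem interpolationError_eq_sum {a : ℝ → ℝ} (ha : a 0 = 0) {n : ℕ} {t s : ℝ}
    (ht : t ∈ Set.Icc (0 : ℝ) 1) (hs : s ∈ Set.Icc (0 : ℝ) 1) :
    interpolationError a n t s = ∑ i ∈ Finset.range (n + 1), ∑ j ∈ Finset.range (n + 1),
      hatSpline n i t * hatSpline n j s * (a (min t s) - a ((min i j : ℕ) / (n : ℝ))) := by
  simp_rw [mul_sub, Finset.sum_sub_distrib, ← Finset.sum_mul]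
  rw [sum_hatSpline_mul_hatSpline ht hs, one_mul, interpolationError]
  congr 1
  rw [sum_Icc_one_eq_sum_range n (by simp [ha])]
  exact Finset.sum_congr rfl fun i _ => sum_Icc_one_eq_sum_range n (by simp [ha])

theorem abs_interpolationError_le {a : ℝ → ℝ} (ha : a 0 = 0) {R : ℝ} (hR : 0 ≤ R)
    (hlip : ∀ u ∈ Set.Icc (0 : ℝ) 1, ∀ v ∈ Set.Icc (0 : ℝ) 1, |a u - a v| ≤ R * |u - v|)
    {n : ℕ} (hn : 0 < n) {t s : ℝ} (ht : t ∈ Set.Icc (0 : ℝ) 1) (hs : s ∈ Set.Icc (0 : ℝ) 1) :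
    |interpolationError a n t s| ≤ R * (1 / n) := by
  rw [interpolationError_eq_sum ha ht hs]
  refine abs_sum_hatSpline_mul_le hn ht hs _ fun i hi j hj h1 h2 => ?_
  have hi' := natCast_div_mem_Icc hn hi
  have hj' := natCast_div_mem_Icc hn hj
  rw [natCast_min_div]
  refine (hlip _ ⟨le_min ht.1 hs.1, min_le_of_left_le ht.2⟩ _
    ⟨le_min hi'.1 hj'.1, min_le_of_left_le hi'.2⟩).trans (mul_le_mul_of_nonneg_left ?_ hR)
  refine (abs_min_sub_min_le_max _ _ _ _).trans (max_le ?_ ?_)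
  · rw [abs_sub_comm]; exact h1.le
  · rw [abs_sub_comm]; exact h2.le

theorem abs_interpolationError_le_of_add_le {a σ : ℝ → ℝ} (ha : a 0 = 0) {R α : ℝ} (hR : 0 ≤ R)
    (hα : 0 ≤ α)
    (htay : ∀ u ∈ Set.Icc (0 : ℝ) 1, ∀ v ∈ Set.Icc (0 : ℝ) 1,
      |a v - a u - σ u * (v - u)| ≤ R * |v - u| ^ α * |v - u|)
    {n : ℕ} (hn : 0 < n) {t s : ℝ} (ht : t ∈ Set.Icc (0 : ℝ) 1) (hs : s ∈ Set.Icc (0 : ℝ) 1)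
    (hts : t + 2 / n ≤ s) :
    |interpolationError a n t s| ≤ R * (1 / n) ^ α * (1 / n) := by
  have hN : (0 : ℝ) < n := by exact_mod_cast hn
  have h2n : (2 : ℝ) / n = 1 / n + 1 / n := by ring
  have hpos : (0 : ℝ) < 1 / n := by positivity
  have hlin : ∑ i ∈ Finset.range (n + 1), ∑ j ∈ Finset.range (n + 1),
      hatSpline n i t * hatSpline n j s * (σ t * ((i : ℝ) / n - t)) = 0 := by
    calc _ = σ t * ∑ i ∈ Finset.range (n + 1), hatSpline n i t * ((i : ℝ) / n - t) *
          ∑ j ∈ Finset.range (n + 1), hatSpline n j s := by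
          simp_rw [Finset.mul_sum]
          exact Finset.sum_congr rfl fun i _ => Finset.sum_congr rfl fun j _ => by ring
      _ = 0 := by
          rw [sum_hatSpline hs]
          simp_rw [mul_one]
          rw [sum_hatSpline_mul_node_sub hn ht, mul_zero]
  rw [interpolationError_eq_sum ha ht hs, ← add_zero (∑ i ∈ _, _), ← hlin,
    ← Finset.sum_add_distrib]
  simp_rw [← Finset.sum_add_distrib, ← mul_add]
  refine abs_sum_hatSpline_mul_le hn ht hs _ fun i hi j hj h1 h2 => ?_
  have hi' := natCast_div_mem_Icc hn hi
  have hmin : min ((i : ℝ) / n) ((j : ℝ) / n) = (i : ℝ) / n := by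
    rw [abs_lt] at h1 h2
    exact min_eq_left (by linarith)
  rw [natCast_min_div, hmin, min_eq_left (by linarith),
    show a t - a (i / n) + σ t * (i / n - t) = -(a (i / n) - a t - σ t * (i / n - t)) by ring,
    abs_neg]
  refine (htay t ht _ hi').trans ?_
  gcongr

section Antiderivative

variable {σ a : ℝ → ℝ} {R : ℝ}

theorem uIoc_subset_Icc_of_mem {u v b c : ℝ} (hu : u ∈ Set.Icc b c) (hv : v ∈ Set.Icc b c) :
    Set.uIoc u v ⊆ Set.Icc b c :=
  Set.uIoc_subset_uIcc.trans (Set.uIcc_subset_Icc hu hv)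

theorem continuousOn_of_abs_sub_le_rpow {α : ℝ} (hα : 0 < α) {S : Set ℝ}
    (h : ∀ s ∈ S, ∀ t ∈ S, |σ t - σ s| ≤ R * |t - s| ^ α) : ContinuousOn σ S := by
  intro s hs
  rw [ContinuousWithinAt, tendsto_iff_norm_sub_tendsto_zero]
  have hlim : Filter.Tendsto (fun t => R * |t - s| ^ α) (nhdsWithin s S) (nhds 0) := by
    have hc : Continuous fun t => R * |t - s| ^ α :=
      continuous_const.mul ((by fun_prop : Continuous fun t => |t - s|).rpow_const
        fun _ => Or.inr hα.le)
    have := (hc.tendsto s).mono_left (nhdsWithin_le_nhds (s := S))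
    simpa [Real.zero_rpow hα.ne'] using this
  refine squeeze_zero' (Filter.Eventually.of_forall fun _ => norm_nonneg _) ?_ hlim
  filter_upwards [self_mem_nhdsWithin] with t ht using h s hs t ht

theorem antiderivative_sub (hσ : ContinuousOn σ (Set.Icc 0 1))
    (ha : ∀ t, a t = ∫ s in (0 : ℝ)..t, σ s)
    {u v : ℝ} (hu : u ∈ Set.Icc (0 : ℝ) 1) (hv : v ∈ Set.Icc (0 : ℝ) 1) :
    a v - a u = ∫ s in u..v, σ s := by
  have h0 : (0 : ℝ) ∈ Set.Icc (0 : ℝ) 1 := by simp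
  rw [ha, ha]
  exact intervalIntegral.integral_interval_sub_left
    (hσ.mono (Set.uIcc_subset_Icc h0 hv)).intervalIntegrable
    (hσ.mono (Set.uIcc_subset_Icc h0 hu)).intervalIntegrable

theorem abs_antiderivative_sub_le (hσ : ContinuousOn σ (Set.Icc 0 1))
    (ha : ∀ t, a t = ∫ s in (0 : ℝ)..t, σ s) (hb : ∀ t ∈ Set.Icc (0 : ℝ) 1, |σ t| ≤ R)
    {u v : ℝ} (hu : u ∈ Set.Icc (0 : ℝ) 1) (hv : v ∈ Set.Icc (0 : ℝ) 1) :
    |a v - a u| ≤ R * |v - u| := by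
  rw [antiderivative_sub hσ ha hu hv]
  rw [← Real.norm_eq_abs]
  refine intervalIntegral.norm_integral_le_of_norm_le_const fun x hx => ?_
  exact hb x (uIoc_subset_Icc_of_mem hu hv hx)

theorem abs_antiderivative_sub_sub_le {α : ℝ} (hα : 0 < α) (hR : 0 ≤ R)
    (ha : ∀ t, a t = ∫ s in (0 : ℝ)..t, σ s)
    (hh : ∀ s ∈ Set.Icc (0 : ℝ) 1, ∀ t ∈ Set.Icc (0 : ℝ) 1, |σ t - σ s| ≤ R * |t - s| ^ α)
    {u v : ℝ} (hu : u ∈ Set.Icc (0 : ℝ) 1) (hv : v ∈ Set.Icc (0 : ℝ) 1) :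
    |a v - a u - σ u * (v - u)| ≤ R * |v - u| ^ α * |v - u| := by
  have hσ := continuousOn_of_abs_sub_le_rpow hα hh
  have hint : ∫ s in u..v, (σ s - σ u) = a v - a u - σ u * (v - u) := by
    rw [intervalIntegral.integral_sub (hσ.mono (Set.uIcc_subset_Icc hu hv)).intervalIntegrable
      intervalIntegrable_const, antiderivative_sub hσ ha hu hv]
    simp [mul_comm]
  rw [← hint, ← Real.norm_eq_abs]
  refine intervalIntegral.norm_integral_le_of_norm_le_const fun x hx => ?_
  refine (hh u hu x (uIoc_subset_Icc_of_mem hu hv hx)).trans ?_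
  have : |x - u| ≤ |v - u| := Set.abs_sub_left_of_mem_uIcc (Set.uIoc_subset_uIcc hx)
  gcongr

end Antiderivative

theorem setIntegral_Icc_zero_one_le_of_near_far {f : ℝ → ℝ} (hf : ∀ s, 0 ≤ f s) {K₁ K₂ t r : ℝ}
    (hK : 0 ≤ K₂) (hr : 0 ≤ r)
    (hle : ∀ s ∈ Set.Icc (0 : ℝ) 1,
      f s ≤ K₁ + (Set.Icc (t - r) (t + r)).indicator (fun _ => K₂) s) :
    ∫ s in Set.Icc (0 : ℝ) 1, f s ≤ K₁ + K₂ * (2 * r) := by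
  have hind : IntegrableOn ((Set.Icc (t - r) (t + r)).indicator fun _ => K₂)
      (Set.Icc (0 : ℝ) 1) :=
    (integrable_const K₂).indicator measurableSet_Icc
  have hg := (integrable_const (μ := volume.restrict (Set.Icc (0 : ℝ) 1)) K₁).add hind
  refine (integral_mono_of_nonneg (Filter.Eventually.of_forall hf) hg ?_).trans ?_
  · exact (ae_restrict_iff' measurableSet_Icc).2 (Filter.Eventually.of_forall hle)
  · simp only [Pi.add_apply]
    rw [integral_add (integrable_const _) hind, MeasureTheory.integral_indicator measurableSet_Icc]
    simp only [MeasureTheory.integral_const, measureReal_restrict_apply_univ, smul_eq_mul]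
    have h1 : volume.real (Set.Icc (0 : ℝ) 1) = 1 := by simp
    have h2 : (volume.restrict (Set.Icc (0 : ℝ) 1)).real (Set.Icc (t - r) (t + r)) ≤ 2 * r := by
      rw [measureReal_restrict_apply measurableSet_Icc]
      refine (measureReal_mono Set.inter_subset_left (by simp)).trans ?_
      rw [Real.volume_real_Icc_of_le (by linarith)]
      linarith
    rw [h1, one_mul, mul_comm K₂]
    gcongr

/-- Bilinear interpolation error bound from the proof of Theorem 1: let
`α ∈ (0,1]`.  There is a constant `C` depending only on `α` such that for every `R > 0`,
every `Σ : [0,1] → ℝ^{2×2}` with `‖Σ(t)‖ ≤ R` and `‖Σ(t) − Σ(s)‖ ≤ R|t−s|^α` (spectral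
norm), `A(t) := ∫_0^t Σ(s) ds`, and every `n ≥ 1`:
`∫_0^1 ∫_0^1 ‖A(min(t,s)) − ∑_{i,j=1}^n A(min(i,j)/n) b_i(t) b_j(s)‖² dt ds
  ≤ C R² n^{−2−min(2α,1)}`. -/
theorem bilinear_interpolation_error_bound (α : ℝ) (hα : α ∈ Set.Ioc (0 : ℝ) 1) :
    ∃ C > 0, ∀ R > (0 : ℝ), ∀ Sig : ℝ → Matrix (Fin 2) (Fin 2) ℝ,
      (∀ t ∈ Set.Icc (0 : ℝ) 1, specNorm2 (Sig t) ≤ R) →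
      (∀ s ∈ Set.Icc (0 : ℝ) 1, ∀ t ∈ Set.Icc (0 : ℝ) 1,
        specNorm2 (Sig t - Sig s) ≤ R * |t - s| ^ α) →
      ∀ A : ℝ → Matrix (Fin 2) (Fin 2) ℝ,
      (∀ t i j, A t i j = ∫ s in (0 : ℝ)..t, Sig s i j) →
      ∀ n : ℕ, 1 ≤ n →
      (∫ t in Set.Icc (0 : ℝ) 1, ∫ s in Set.Icc (0 : ℝ) 1,
          specNorm2 (A (min t s) -
            ∑ i ∈ Finset.Icc 1 n, ∑ j ∈ Finset.Icc 1 n,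
              (hatSpline n i t * hatSpline n j s) • A ((min i j : ℕ) / (n : ℝ))) ^ 2) ≤
        C * R ^ 2 * (n : ℝ) ^ (-(2 + min (2 * α) 1)) := by
  have hα0 := hα.1
  refine ⟨80, by norm_num, fun R hR Sig hb hh A hA n hn => ?_⟩
  have hN : (1 : ℝ) ≤ n := by exact_mod_cast hn
  have hN0 : (0 : ℝ) < n := by linarith
  set E : ℝ → ℝ → Matrix (Fin 2) (Fin 2) ℝ := fun t s => A (min t s) -
    ∑ i ∈ Finset.Icc 1 n, ∑ j ∈ Finset.Icc 1 n,
      (hatSpline n i t * hatSpline n j s) • A ((min i j : ℕ) / (n : ℝ)) with hE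
  have hentry : ∀ t s p q, E t s p q = interpolationError (fun t => A t p q) n t s := by
    intro t s p q
    simp [hE, interpolationError, Matrix.sum_apply]
  have hA0 : ∀ p q, A 0 p q = 0 := fun p q => by simp [hA]
  have hbe : ∀ p q, ∀ t ∈ Set.Icc (0 : ℝ) 1, |Sig t p q| ≤ R := fun p q t ht =>
    (abs_apply_le_specNorm2 _ p q).trans (hb t ht)
  have hhe : ∀ p q, ∀ s ∈ Set.Icc (0 : ℝ) 1, ∀ t ∈ Set.Icc (0 : ℝ) 1,
      |Sig t p q - Sig s p q| ≤ R * |t - s| ^ α := fun p q s hs t ht =>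
    (abs_apply_le_specNorm2 (Sig t - Sig s) p q).trans (hh s hs t ht)
  have hnorm : ∀ t s K, (∀ p q, |E t s p q| ≤ K) → specNorm2 (E t s) ^ 2 ≤ 16 * K ^ 2 := by
    intro t s K hK
    have h := specNorm2_le_sum_abs (E t s)
    simp only [Fin.sum_univ_two] at h
    have h4 : specNorm2 (E t s) ≤ 4 * K := by
      linarith [hK 0 0, hK 0 1, hK 1 0, hK 1 1]
    calc specNorm2 (E t s) ^ 2 ≤ (4 * K) ^ 2 := pow_le_pow_left₀ (norm_nonneg _) h4 2
      _ = 16 * K ^ 2 := by ring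
  have hglobal : ∀ t ∈ Set.Icc (0 : ℝ) 1, ∀ s ∈ Set.Icc (0 : ℝ) 1,
      specNorm2 (E t s) ^ 2 ≤ 16 * (R * (1 / n)) ^ 2 := by
    intro t ht s hs
    refine hnorm t s _ fun p q => ?_
    rw [hentry]
    exact abs_interpolationError_le (hA0 p q) hR.le
      (fun u hu v hv => abs_antiderivative_sub_le (continuousOn_of_abs_sub_le_rpow hα0 (hhe p q))
        (fun t => hA t p q) (hbe p q) hv hu) hn ht hs
  have hfar : ∀ t ∈ Set.Icc (0 : ℝ) 1, ∀ s ∈ Set.Icc (0 : ℝ) 1,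
      s ∉ Set.Icc (t - 2 / n) (t + 2 / n) →
      specNorm2 (E t s) ^ 2 ≤ 16 * (R * (1 / n) ^ α * (1 / n)) ^ 2 := by
    intro t ht s hs hts
    refine hnorm t s _ fun p q => ?_
    rw [hentry]
    have htay : ∀ u ∈ Set.Icc (0 : ℝ) 1, ∀ v ∈ Set.Icc (0 : ℝ) 1,
        |A v p q - A u p q - Sig u p q * (v - u)| ≤ R * |v - u| ^ α * |v - u| :=
      fun u hu v hv => abs_antiderivative_sub_sub_le hα0 hR.le
        (a := fun t => A t p q) (fun t => hA t p q) (hhe p q) hu hv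
    rcases le_or_gt (t - 2 / n) s with h | h
    · exact abs_interpolationError_le_of_add_le (hA0 p q) hR.le hα0.le htay hn ht hs
        (not_le.1 fun hlt => hts ⟨h, hlt⟩).le
    · rw [interpolationError_comm]
      exact abs_interpolationError_le_of_add_le (hA0 p q) hR.le hα0.le htay hn hs ht
        (by linarith)
  have hinner : ∀ t ∈ Set.Icc (0 : ℝ) 1, ∫ s in Set.Icc (0 : ℝ) 1, specNorm2 (E t s) ^ 2 ≤
      16 * (R * (1 / n) ^ α * (1 / n)) ^ 2 + 16 * (R * (1 / n)) ^ 2 * (2 * (2 / n)) := by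
    intro t ht
    refine setIntegral_Icc_zero_one_le_of_near_far (t := t) (fun s => by positivity)
      (by positivity) (by positivity) fun s hs => ?_
    by_cases hts : s ∈ Set.Icc (t - 2 / n) (t + 2 / n)
    · rw [Set.indicator_of_mem hts]
      exact (hglobal t ht s hs).trans (le_add_of_nonneg_left (by positivity))
    · rw [Set.indicator_of_notMem hts, add_zero]
      exact hfar t ht s hs hts
  have houter := setIntegral_Icc_zero_one_le_of_near_far (t := 0) (r := 0) (K₂ := 0)
    (f := fun t => ∫ s in Set.Icc (0 : ℝ) 1, specNorm2 (E t s) ^ 2)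
    (fun t => integral_nonneg fun s => by positivity) le_rfl le_rfl
    (fun t ht => (hinner t ht).trans (le_add_of_nonneg_right (by simp)))
  refine houter.trans ?_
  have e1 : ((1 / n : ℝ) ^ α * (1 / n)) ^ 2 = (n : ℝ) ^ (-(2 + 2 * α)) := by
    rw [one_div, Real.inv_rpow hN0.le, ← Real.rpow_neg hN0.le, ← Real.rpow_neg_one,
      ← Real.rpow_add hN0, ← Real.rpow_natCast, ← Real.rpow_mul hN0.le]
    congr 1
    push_cast
    ring
  have e2 : (1 / n : ℝ) ^ 2 * (1 / n) = (n : ℝ) ^ (-(2 + 1) : ℝ) := by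
    rw [Real.rpow_neg hN0.le, show (2 + 1 : ℝ) = (3 : ℕ) by norm_num, Real.rpow_natCast]
    field_simp
  have l1 : (n : ℝ) ^ (-(2 + 2 * α)) ≤ (n : ℝ) ^ (-(2 + min (2 * α) 1)) :=
    Real.rpow_le_rpow_of_exponent_le hN (by linarith [min_le_left (2 * α) 1])
  have l2 : (n : ℝ) ^ (-(2 + 1) : ℝ) ≤ (n : ℝ) ^ (-(2 + min (2 * α) 1)) :=
    Real.rpow_le_rpow_of_exponent_le hN (by linarith [min_le_right (2 * α) 1])
  calc _ = 16 * R ^ 2 * ((1 / n : ℝ) ^ α * (1 / n)) ^ 2 +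
        64 * R ^ 2 * ((1 / n : ℝ) ^ 2 * (1 / n)) := by ring
    _ ≤ 16 * R ^ 2 * (n : ℝ) ^ (-(2 + min (2 * α) 1)) +
        64 * R ^ 2 * (n : ℝ) ^ (-(2 + min (2 * α) 1)) := by
        rw [e1, e2]
        gcongr
    _ = 80 * R ^ 2 * (n : ℝ) ^ (-(2 + min (2 * α) 1)) := by ring
end

section
/- (Off-diagonal exactness of bilinear interpolation from the proof of Proposition 2) Let n ≥ 1 and let Σ : [0,1] → ℝ^{2×2} be constant on each interval [(i−1)/n, i/n), i = 1,…,n, and set A(t) := ∫_0^t Σ(s) ds, so that A is piecewise affine with A(0) = 0. With the hat functions b_i(t) := max(0, 1 − |nt − i|), i = 1,…,n, one has for every (t,s) ∈ [0,1]² with ⌈nt⌉ ≠ ⌈ns⌉ (that is, t and s lie in different subintervals of the grid of mesh 1/n): A(min(t,s)) = ∑_{i,j=1}^n A(min(i,j)/n) b_i(t) b_j(s). -/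
open MeasureTheory Set Finset intervalIntegral

theorem hatSpline_eq_zero {n i : ℕ} {t : ℝ} (h : 1 ≤ |(n : ℝ) * t - (i : ℝ)|) :
    hatSpline n i t = 0 :=
  max_eq_left (by linarith)

/-- On a grid cell, hat functions interpolate linearly between the two endpoint values. -/
theorem sum_hatSpline_smul {E : Type*} [AddCommGroup E] [Module ℝ E] {n m : ℕ} {x : ℝ}
    (f : ℕ → E) (hf : f 0 = 0) (hmn : m + 1 ≤ n) (hl : (m : ℝ) ≤ n * x)
    (hu : (n : ℝ) * x ≤ m + 1) :
    ∑ i ∈ Finset.Icc 1 n, hatSpline n i x • f i =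
      ((m : ℝ) + 1 - n * x) • f m + ((n : ℝ) * x - m) • f (m + 1) := by
  have hsub : ∑ i ∈ Finset.Icc 1 n, hatSpline n i x • f i =
      ∑ i ∈ Finset.range (n + 1), hatSpline n i x • f i := by
    refine Finset.sum_subset (fun i hi => ?_) (fun i hi hi' => ?_)
    · simp only [Finset.mem_Icc, Finset.mem_range] at hi ⊢
      omega
    · obtain rfl : i = 0 := by
        simp only [Finset.mem_Icc, Finset.mem_range] at hi hi'
        omega
      rw [hf, smul_zero]
  have hleft : hatSpline n m x = (m : ℝ) + 1 - n * x := by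
    rw [hatSpline, abs_of_nonneg (by linarith), max_eq_right (by linarith)]
    ring
  have hright : hatSpline n (m + 1) x = (n : ℝ) * x - m := by
    rw [hatSpline, abs_of_nonpos (by push_cast; linarith),
      max_eq_right (by push_cast; linarith)]
    push_cast
    ring
  rw [hsub, Finset.sum_eq_add_of_mem m (m + 1) (Finset.mem_range.2 (by omega))
    (Finset.mem_range.2 (by omega)) (by omega), hleft, hright]
  rintro i - ⟨him, him'⟩
  rw [hatSpline_eq_zero, zero_smul]
  rcases lt_or_gt_of_ne him with h | h
  · have : (i : ℝ) + 1 ≤ m := by exact_mod_cast h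
    exact le_abs.2 (Or.inl (by linarith))
  · have : (m : ℝ) + 1 + 1 ≤ i := by
      have : m + 1 + 1 ≤ i := by omega
      exact_mod_cast this
    exact le_abs.2 (Or.inr (by linarith))

theorem exists_nat_grid_cell {n : ℕ} {t : ℝ} (h0 : 0 < ⌈(n : ℝ) * t⌉) (h1 : t ≤ 1) :
    ∃ m : ℕ, m + 1 ≤ n ∧ ⌈(n : ℝ) * t⌉ = m + 1 ∧ (m : ℝ) < n * t ∧ (n : ℝ) * t ≤ m + 1 := by
  obtain ⟨m, hm⟩ : ∃ m : ℕ, ⌈(n : ℝ) * t⌉ = m + 1 :=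
    ⟨(⌈(n : ℝ) * t⌉ - 1).toNat, by omega⟩
  obtain ⟨hl, hu⟩ := Int.ceil_eq_iff.1 hm
  push_cast at hl hu
  have hmt : (m : ℝ) < n * t := by linarith
  refine ⟨m, ?_, hm, hmt, hu⟩
  have : (m : ℝ) < n := hmt.trans_le (mul_le_of_le_one_right n.cast_nonneg h1)
  exact_mod_cast this

theorem intervalIntegrable_of_eqOn_Ioo_const {g : ℝ → ℝ} {a b c : ℝ} (hab : a ≤ b)
    (h : ∀ x ∈ Set.Ioo a b, g x = c) : IntervalIntegrable g volume a b := by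
  refine (intervalIntegrable_congr_uIoo (g := fun _ => c) ?_).2 intervalIntegrable_const
  rw [uIoo_of_le hab]
  exact h

theorem integral_of_eqOn_Ioo_const {g : ℝ → ℝ} {a b c : ℝ} (hab : a ≤ b)
    (h : ∀ x ∈ Set.Ioo a b, g x = c) : ∫ x in a..b, g x = (b - a) * c := by
  rw [integral_congr_Ioo_of_le (g := fun _ => c) hab h, intervalIntegral.integral_const,
    smul_eq_mul]

/-- The antiderivative of a function that is constant on grid cells is affine on each cell. -/
theorem integral_eq_of_piecewise_const {n m : ℕ} {g : ℝ → ℝ} {c : ℕ → ℝ} {t : ℝ}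
    (hg : ∀ k < n, ∀ x ∈ Set.Ioo ((k : ℝ) / n) (((k + 1 : ℕ) : ℝ) / n), g x = c k)
    (hmn : m + 1 ≤ n) (hl : (m : ℝ) ≤ n * t) (hu : (n : ℝ) * t ≤ m + 1) :
    ∫ x in (0 : ℝ)..t, g x =
      ((m : ℝ) + 1 - n * t) * (∫ x in (0 : ℝ)..((m : ℝ) / n), g x) +
        ((n : ℝ) * t - m) * ∫ x in (0 : ℝ)..(((m + 1 : ℕ) : ℝ) / n), g x := by
  have hn : (0 : ℝ) < n := by
    have : 0 < n := by omega
    exact_mod_cast this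
  have hcell (k : ℕ) : (k : ℝ) / n ≤ ((k + 1 : ℕ) : ℝ) / n := by
    gcongr
    omega
  have hint : IntervalIntegrable g volume 0 ((m : ℝ) / n) := by
    have := IntervalIntegrable.trans_iterate (f := g) (μ := volume)
      (a := fun k : ℕ => (k : ℝ) / n) (n := m)
      fun k hk => intervalIntegrable_of_eqOn_Ioo_const (hcell k) (hg k (by omega))
    simpa using this
  have hadd {x : ℝ} (hx : (m : ℝ) / n ≤ x) (hx' : x ≤ ((m + 1 : ℕ) : ℝ) / n) :
      ∫ y in (0 : ℝ)..x, g y = (∫ y in (0 : ℝ)..((m : ℝ) / n), g y) + (x - m / n) * c m := by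
    have hc : ∀ y ∈ Set.Ioo ((m : ℝ) / n) x, g y = c m :=
      fun y hy => hg m (by omega) y ⟨hy.1, hy.2.trans_le hx'⟩
    rw [← integral_add_adjacent_intervals hint (intervalIntegrable_of_eqOn_Ioo_const hx hc),
      integral_of_eqOn_Ioo_const hx hc]
  rw [hadd (x := t) ((div_le_iff₀ hn).2 (by linarith))
      ((le_div_iff₀ hn).2 (by push_cast; linarith)), hadd (hcell m) le_rfl]
  push_cast
  field_simp
  ring

/-- Exactness of bilinear interpolation of `a (min t s)` for a function `a` that vanishes at `0`
and is affine on each grid cell, when `t` lies in an earlier cell than `s`. -/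
theorem sum_hatSpline_mul_hatSpline_smul_min {E : Type*} [AddCommGroup E] [Module ℝ E] {n : ℕ}
    (hn : 1 ≤ n) {a : ℝ → E} (ha0 : a 0 = 0)
    (ha : ∀ m : ℕ, m + 1 ≤ n → ∀ t : ℝ, (m : ℝ) ≤ n * t → (n : ℝ) * t ≤ m + 1 →
      a t = ((m : ℝ) + 1 - n * t) • a (m / n) + ((n : ℝ) * t - m) • a ((m + 1 : ℕ) / n))
    {t s : ℝ} (ht : t ∈ Set.Icc (0 : ℝ) 1) (hs : s ∈ Set.Icc (0 : ℝ) 1)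
    (hts : ⌈(n : ℝ) * t⌉ < ⌈(n : ℝ) * s⌉) :
    ∑ i ∈ Finset.Icc 1 n, ∑ j ∈ Finset.Icc 1 n,
      (hatSpline n i t * hatSpline n j s) • a ((min i j : ℕ) / (n : ℝ)) = a (min t s) := by
  have hn' : (0 : ℝ) < n := by exact_mod_cast hn
  have hlt : t < s := by
    by_contra! h
    exact hts.not_ge (Int.ceil_mono (mul_le_mul_of_nonneg_left h hn'.le))
  rw [min_eq_left hlt.le]
  have hnt : 0 ≤ ⌈(n : ℝ) * t⌉ := Int.ceil_nonneg (mul_nonneg hn'.le ht.1)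
  obtain ⟨p, hpn, hp, hpl, hpu⟩ := exists_nat_grid_cell (hnt.trans_lt hts) hs.2
  have hinner (i : ℕ) : ∑ j ∈ Finset.Icc 1 n,
      (hatSpline n i t * hatSpline n j s) • a ((min i j : ℕ) / (n : ℝ)) =
      hatSpline n i t • (((p : ℝ) + 1 - n * s) • a ((min i p : ℕ) / (n : ℝ)) +
        ((n : ℝ) * s - p) • a ((min i (p + 1) : ℕ) / (n : ℝ))) := by
    rw [← sum_hatSpline_smul (fun j : ℕ => a ((min i j : ℕ) / (n : ℝ))) (by simp [ha0])
      hpn hpl.le hpu, Finset.smul_sum]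
    simp only [mul_smul]
  simp only [hinner]
  rcases hnt.eq_or_lt with h0 | h0
  · have hle : (n : ℝ) * t ≤ 0 := by simpa using Int.ceil_le.1 h0.ge
    have ht0 : t = 0 := le_antisymm (by nlinarith) ht.1
    rw [ht0, ha0]
    refine Finset.sum_eq_zero fun i hi => ?_
    have : (1 : ℝ) ≤ i := by exact_mod_cast (Finset.mem_Icc.1 hi).1
    rw [hatSpline_eq_zero (le_abs.2 (Or.inr (by linarith))), zero_smul]
  · obtain ⟨m, hmn, hm, hml, hmu⟩ := exists_nat_grid_cell h0 ht.2
    have hmp : m + 1 ≤ p := by omega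
    have hconv (x : E) : ((p : ℝ) + 1 - n * s) • x + ((n : ℝ) * s - p) • x = x := by
      rw [← add_smul]
      ring_nf
      exact one_smul ℝ x
    rw [sum_hatSpline_smul (fun i : ℕ => ((p : ℝ) + 1 - n * s) • a ((min i p : ℕ) / (n : ℝ)) +
        ((n : ℝ) * s - p) • a ((min i (p + 1) : ℕ) / (n : ℝ))) (by simp [ha0]) hmn hml.le hmu]
    rw [min_eq_left (by omega : m ≤ p), min_eq_left (by omega : m ≤ p + 1), min_eq_left hmp,
      min_eq_left (by omega : m + 1 ≤ p + 1), hconv, hconv, ← ha m hmn t hml.le hmu]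

/-- Off-diagonal exactness of bilinear interpolation from the proof of
Proposition 2: let `n ≥ 1` and let `Σ : [0,1] → ℝ^{2×2}` be constant on each interval
`[(i−1)/n, i/n)`, and set `A(t) := ∫_0^t Σ(s) ds`.  Then for every `(t,s) ∈ [0,1]²` with
`⌈nt⌉ ≠ ⌈ns⌉` one has `A(min(t,s)) = ∑_{i,j=1}^n A(min(i,j)/n) b_i(t) b_j(s)`. -/
theorem bilinear_interpolation_offdiagonal_exact
    (n : ℕ) (hn : 1 ≤ n) (Sig : ℝ → Matrix (Fin 2) (Fin 2) ℝ)
    (hSigConst : ∀ i ∈ Finset.Icc 1 n, ∀ s ∈ Set.Ico (((i : ℝ) - 1) / n) ((i : ℝ) / n),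
      ∀ t ∈ Set.Ico (((i : ℝ) - 1) / n) ((i : ℝ) / n), Sig s = Sig t)
    (A : ℝ → Matrix (Fin 2) (Fin 2) ℝ)
    (hA : ∀ t i j, A t i j = ∫ s in (0 : ℝ)..t, Sig s i j)
    (t s : ℝ) (ht : t ∈ Set.Icc (0 : ℝ) 1) (hs : s ∈ Set.Icc (0 : ℝ) 1)
    (hts : ⌈(n : ℝ) * t⌉ ≠ ⌈(n : ℝ) * s⌉) :
    A (min t s) =
      ∑ i ∈ Finset.Icc 1 n, ∑ j ∈ Finset.Icc 1 n,
        (hatSpline n i t * hatSpline n j s) • A ((min i j : ℕ) / (n : ℝ)) := by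
  have hA0 : A 0 = 0 := by
    ext i j
    simp [hA]
  have haff : ∀ m : ℕ, m + 1 ≤ n → ∀ t : ℝ, (m : ℝ) ≤ n * t → (n : ℝ) * t ≤ m + 1 →
      A t = ((m : ℝ) + 1 - n * t) • A (m / n) +
        ((n : ℝ) * t - m) • A ((m + 1 : ℕ) / n) := by
    intro m hmn t hl hu
    ext i j
    simp only [Matrix.add_apply, Matrix.smul_apply, smul_eq_mul, hA]
    refine integral_eq_of_piecewise_const (c := fun k => Sig ((k : ℝ) / n) i j) ?_ hmn hl hu
    intro k hk x hx
    have hcell := hSigConst (k + 1) (Finset.mem_Icc.2 ⟨by omega, hk⟩)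
    have hk' : (((k + 1 : ℕ) : ℝ) - 1) / n = k / n := by
      push_cast
      ring
    rw [hk'] at hcell
    rw [hcell x ⟨hx.1.le, hx.2⟩ (k / n) ⟨le_rfl, hx.1.trans hx.2⟩]
  rcases lt_or_gt_of_ne hts with h | h
  · exact (sum_hatSpline_mul_hatSpline_smul_min hn hA0 haff ht hs h).symm
  · rw [min_comm, ← sum_hatSpline_mul_hatSpline_smul_min hn hA0 haff hs ht h, Finset.sum_comm]
    simp only [min_comm, mul_comm]
end
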